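/- Thompson's group T does not have Kazhdan's property (T): for every finite subset S ⊆ T and every ε > 0, there exist a complex Hilbert space H, a group homomorphism π from T to the group of unitary operators on H, and a unit vector ξ ∈ H such that ‖π(s)ξ − ξ‖ < ε for all s ∈ S, while the only vector of H fixed by π(g) for all g ∈ T is the zero vector. -/

import Mathlib

/-- A dyadic rational: a number of the form `a / 2 ^ b` with `a, b` integers. -/
def IsDyadic (x : ℝ) : Prop := ∃ (a : ℤ) (b : ℕ), x = (a : ℝ) / 2 ^ b

/-- A lift `G : ℝ → ℝ` of an element of Thompson's group `T`: an increasing continuous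
map commuting with the translation by `1`, mapping dyadic rationals to dyadic rationals,
piecewise linear on `[0,1]` with finitely many breakpoints, all breakpoints at dyadic
rationals and all slopes integer powers of `2`. -/
def IsPLCircleLift (G : ℝ → ℝ) : Prop :=
  Continuous G ∧ StrictMono G ∧ (∀ x : ℝ, G (x + 1) = G x + 1) ∧
  (∀ q : ℝ, IsDyadic q → IsDyadic (G q)) ∧
  ∃ (n : ℕ) (x : Fin (n + 1) → ℝ),
    x 0 = 0 ∧ x (Fin.last n) = 1 ∧ StrictMono x ∧ (∀ i, IsDyadic (x i)) ∧
    ∀ i : Fin n, ∃ (k : ℤ) (c : ℝ),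
      ∀ t ∈ Set.Icc (x i.castSucc) (x i.succ), G t = (2 : ℝ) ^ k * t + c

/-- Membership in Thompson's group `T`: an orientation-preserving homeomorphism of the
circle `ℝ/ℤ` mapping dyadic rationals onto themselves, piecewise linear with finitely
many breakpoints, all breakpoints at dyadic rationals and all slopes integer powers
of `2`; equivalently, a homeomorphism admitting a lift as above. -/
def IsThompsonT (g : AddCircle (1:ℝ) ≃ₜ AddCircle (1:ℝ)) : Prop :=
  ∃ G : ℝ → ℝ, IsPLCircleLift G ∧ ∀ x : ℝ, g (x : AddCircle (1:ℝ)) = ((G x : ℝ) : AddCircle (1:ℝ))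

/-- The group of homeomorphisms of a space, under composition. -/
instance homeoGroup {X : Type*} [TopologicalSpace X] : Group (X ≃ₜ X) where
  mul g h := h.trans g
  one := Homeomorph.refl X
  inv := Homeomorph.symm
  mul_assoc a b c := Homeomorph.ext fun _ => rfl
  one_mul a := Homeomorph.ext fun _ => rfl
  mul_one a := Homeomorph.ext fun _ => rfl
  inv_mul_cancel a := Homeomorph.ext a.symm_apply_apply

/-- Passing to the orthogonal complement of the fixed vectors: a unitary representation with a
vector that is moved little by `S`, but far by some element, yields one without nonzero fixed
vectors in which some unit vector is still moved little by `S`. -/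
theorem exists_rep_without_fixed_vectors {G E : Type} [Group G] [NormedAddCommGroup E]
    [InnerProductSpace ℂ E] [CompleteSpace E] (π : G →* (E ≃ₗᵢ[ℂ] E)) (ξ : E) (S : Finset G)
    (ε : ℝ) (hS : ∀ s ∈ S, ‖π s ξ - ξ‖ < ε / 2) (hg : ∃ g, 1 ≤ ‖π g ξ - ξ‖) :
    ∃ (E' : Type) (_ : NormedAddCommGroup E') (_ : InnerProductSpace ℂ E')
      (_ : CompleteSpace E') (π' : G →* (E' ≃ₗᵢ[ℂ] E')) (ξ' : E'),
      ‖ξ'‖ = 1 ∧ (∀ s ∈ S, ‖π' s ξ' - ξ'‖ < ε) ∧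
      ∀ v : E', (∀ g : G, π' g v = v) → v = 0 := by
  let F : Submodule ℂ E :=
    { carrier := {v | ∀ g, π g v = v}
      add_mem' := fun ha hb g => by rw [map_add, ha g, hb g]
      zero_mem' := fun g => map_zero _
      smul_mem' := fun c v hv g => by rw [map_smul, hv g] }
  have memF : ∀ v, v ∈ F ↔ ∀ g, π g v = v := fun v => Iff.rfl
  have hFc : IsClosed (F : Set E) := by
    have : (F : Set E) = ⋂ g, {v | π g v = v} := by
      ext v; simp [memF]
    rw [this]
    exact isClosed_iInter fun g => isClosed_eq (π g).continuous continuous_id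
  have : CompleteSpace F := hFc.completeSpace_coe
  have hmap : ∀ g, ∀ v ∈ Fᗮ, π g v ∈ Fᗮ := by
    intro g v hv
    rw [Submodule.mem_orthogonal] at hv ⊢
    intro u hu
    rw [← (memF u).1 hu g, LinearIsometryEquiv.inner_map_map]
    exact hv u hu
  have hmul : ∀ (g h : G) (v : E), π (g * h) v = π g (π h v) := fun g h v => by
    rw [map_mul]; rfl
  have hone : ∀ v : E, π 1 v = v := fun v => by
    rw [map_one]; rfl
  let π' : G →* (Fᗮ ≃ₗᵢ[ℂ] Fᗮ) :=
    { toFun := fun g =>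
        { toFun := fun v => ⟨π g v, hmap g v v.2⟩
          invFun := fun v => ⟨π g⁻¹ v, hmap g⁻¹ v v.2⟩
          map_add' := fun a b => Subtype.ext (map_add (π g) (a : E) b)
          map_smul' := fun c a => Subtype.ext (map_smul (π g) c (a : E))
          left_inv := fun v => Subtype.ext (by
            change π g⁻¹ (π g v) = v
            rw [← hmul, inv_mul_cancel, hone])
          right_inv := fun v => Subtype.ext (by
            change π g (π g⁻¹ v) = v
            rw [← hmul, mul_inv_cancel, hone])
          norm_map' := fun v => (π g).norm_map v }
      map_one' := by
        ext v
        exact hone v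
      map_mul' := fun g h => by
        ext v
        exact hmul g h v }
  have hπ' : ∀ g (v : Fᗮ), ((π' g v : Fᗮ) : E) = π g v := fun g v => rfl
  obtain ⟨p, hp, η, hη, rfl⟩ := F.exists_add_mem_mem_orthogonal ξ
  have hdiff : ∀ g, π g (p + η) - (p + η) = π g η - η := fun g => by
    rw [map_add, (memF p).1 hp g]; abel
  have hη2 : 1 / 2 ≤ ‖η‖ := by
    obtain ⟨g, hg⟩ := hg
    rw [hdiff] at hg
    have := norm_sub_le (π g η) η
    rw [(π g).norm_map] at this
    linarith
  have hη0 : 0 < ‖η‖ := by linarith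
  refine ⟨Fᗮ, inferInstance, inferInstance, inferInstance, π',
    ((‖η‖⁻¹ : ℝ) : ℂ) • (⟨η, hη⟩ : Fᗮ), ?_, ?_, ?_⟩
  · rw [norm_smul, Submodule.coe_norm, Complex.norm_real, norm_inv, norm_norm]
    exact inv_mul_cancel₀ hη0.ne'
  · intro s hs
    have h1 := hS s hs
    rw [hdiff] at h1
    rw [map_smul, ← smul_sub, norm_smul, Complex.norm_real, norm_inv, norm_norm,
      Submodule.coe_norm, Submodule.coe_sub, hπ', inv_mul_lt_iff₀ hη0]
    change ‖π s η - η‖ < _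
    nlinarith [norm_nonneg (π s η - η)]
  · intro v hv
    have h1 : (v : E) ∈ F := fun g => by rw [← hπ', hv g]
    have := (Submodule.mem_orthogonal _ _).1 v.2 v h1
    exact Subtype.ext (inner_self_eq_zero.1 this)

open MeasureTheory in
/-- The unitary (Koopman) representation on `L²` of a measure preserving action. -/
theorem exists_koopman_rep {G Y : Type} [Group G] [MeasurableSpace Y] (μ : Measure Y)
    (a : G → Y → Y) (hone : ∀ y, a 1 y = y) (hmul : ∀ g h y, a (g * h) y = a g (a h y))
    (hμ : ∀ g, MeasurePreserving (a g) μ μ) :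
    ∃ π : G →* (Lp ℂ 2 μ ≃ₗᵢ[ℂ] Lp ℂ 2 μ), ∀ g (f : Y → ℂ) (hf : MemLp f 2 μ),
      π g hf.toLp = (hf.comp_measurePreserving (hμ g⁻¹)).toLp := by
  let _ : MulAction G Y := { smul := a, one_smul := hone, mul_smul := hmul }
  have : MeasurableConstSMul G Y := ⟨fun g => (hμ g).measurable⟩
  have : SMulInvariantMeasure G Y μ :=
    ⟨fun g _ hs => (hμ g).measure_preimage hs.nullMeasurableSet⟩
  refine ⟨
    { toFun := fun g =>
        { toFun := fun f => DomMulAct.mk g⁻¹ • f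
          invFun := fun f => DomMulAct.mk g • f
          map_add' := fun f₁ f₂ => smul_add _ _ _
          map_smul' := fun c f => smul_comm _ _ _
          left_inv := fun f => by
            change DomMulAct.mk g • DomMulAct.mk g⁻¹ • f = f
            rw [smul_smul, ← DomMulAct.mk_mul, inv_mul_cancel, DomMulAct.mk_one, one_smul]
          right_inv := fun f => by
            change DomMulAct.mk g⁻¹ • DomMulAct.mk g • f = f
            rw [smul_smul, ← DomMulAct.mk_mul, mul_inv_cancel, DomMulAct.mk_one, one_smul]
          norm_map' := fun f => DomMulAct.norm_smul_Lp _ f }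
      map_one' := by
        ext1 f
        change DomMulAct.mk (1 : G)⁻¹ • f = f
        rw [inv_one, DomMulAct.mk_one, one_smul]
      map_mul' := fun g h => by
        ext1 f
        change DomMulAct.mk (g * h)⁻¹ • f = DomMulAct.mk g⁻¹ • DomMulAct.mk h⁻¹ • f
        rw [smul_smul, ← DomMulAct.mk_mul, mul_inv_rev] }, ?_⟩
  intro g f hf
  exact DomMulAct.mk_smul_toLp g⁻¹ hf

instance : DiscreteMeasurableSpace ℤˣ :=
  ⟨fun s => ⟨Units.val '' s, .of_discrete, Set.preimage_image_eq _ Units.val_injective⟩⟩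

instance : MeasurableMul₂ ℤˣ := ⟨.of_discrete⟩

section SignMeasure
open MeasureTheory

/-- The measure on `{1, -1}` with total mass one and mean `r`, for `-1 ≤ r ≤ 1`. -/
noncomputable def signMeasure (r : ℝ) : Measure ℤˣ :=
  ENNReal.ofReal ((1 + r) / 2) • Measure.dirac 1 +
    ENNReal.ofReal ((1 - r) / 2) • Measure.dirac (-1)

theorem isProbabilityMeasure_signMeasure {r : ℝ} (h₁ : -1 ≤ r) (h₂ : r ≤ 1) :
    IsProbabilityMeasure (signMeasure r) := by
  constructor
  simp only [signMeasure, Measure.add_apply, Measure.smul_apply, measure_univ, smul_eq_mul,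
    mul_one]
  rw [← ENNReal.ofReal_add (by linarith) (by linarith), ← ENNReal.ofReal_one]
  congr 1
  ring

theorem integral_signMeasure {r : ℝ} (h₁ : -1 ≤ r) (h₂ : r ≤ 1) :
    ∫ u, ((u : ℤ) : ℝ) ∂signMeasure r = r := by
  have hi : ∀ (c : ℝ) (v : ℤˣ), Integrable (fun u : ℤˣ => ((u : ℤ) : ℝ))
      (ENNReal.ofReal c • Measure.dirac v) := fun c v =>
    (integrable_dirac (by simp)).smul_measure ENNReal.ofReal_ne_top
  rw [signMeasure, integral_add_measure (hi _ _) (hi _ _), integral_smul_measure,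
    integral_smul_measure, integral_dirac, integral_dirac,
    ENNReal.toReal_ofReal (by linarith), ENNReal.toReal_ofReal (by linarith)]
  simp
  ring

theorem map_mul_left_signMeasure_zero (v : ℤˣ) :
    (signMeasure 0).map (fun u => v * u) = signMeasure 0 := by
  rw [signMeasure, Measure.map_add _ _ .of_discrete, Measure.map_smul, Measure.map_smul,
    Measure.map_dirac, Measure.map_dirac]
  rcases Int.units_eq_one_or v with rfl | rfl
  · simp
  · simp [add_comm]

end SignMeasure

section FlipSign
open MeasureTheory

variable {G X : Type} [Group G] [MulAction G X]

open Classical in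
/-- The product of the signs `ω x` over the points `x` at which `A` and `g⁻¹ • A` differ. -/
noncomputable def flipSign (A : Set X) (g : G) (ω : X → ℤˣ) : ℤˣ :=
  ∏ᶠ x, (if x ∈ A then ω x else 1) * (if g • x ∈ A then ω x else 1)

open Classical in
theorem mulSupport_flipSign_subset (A : Set X) (g : G) (ω : X → ℤˣ) :
    (Function.mulSupport fun x =>
      (if x ∈ A then ω x else 1) * (if g • x ∈ A then ω x else 1)) ⊆
      {x | ¬(g • x ∈ A ↔ x ∈ A)} := by
  intro x hx h
  refine hx ?_
  by_cases h₁ : x ∈ A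
  · simp [h₁, h.2 h₁, Int.units_mul_self]
  · simp [h₁, h]

theorem flipSign_eq_prod {A : Set X} {g : G} (hg : {x | ¬(g • x ∈ A ↔ x ∈ A)}.Finite)
    (ω : X → ℤˣ) : flipSign A g ω = ∏ x ∈ hg.toFinset, ω x := by
  rw [flipSign, finprod_eq_prod_of_mulSupport_subset (s := hg.toFinset)
    _ (by simpa using mulSupport_flipSign_subset A g ω)]
  refine Finset.prod_congr rfl fun x hx => ?_
  rw [Set.Finite.mem_toFinset, Set.mem_ofPred_eq] at hx
  by_cases h₁ : x ∈ A <;> by_cases h₂ : g • x ∈ A <;> simp_all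

theorem flipSign_one (A : Set X) (ω : X → ℤˣ) : flipSign A (1 : G) ω = 1 := by
  rw [flipSign]
  refine finprod_eq_one_of_forall_eq_one fun x => ?_
  rw [one_smul]
  exact Int.units_mul_self _

theorem flipSign_mul {A : Set X} (hA : ∀ g : G, {x | ¬(g • x ∈ A ↔ x ∈ A)}.Finite) (g h : G)
    (ω : X → ℤˣ) :
    flipSign A (g * h) ω = flipSign A g (fun x => ω (h⁻¹ • x)) * flipSign A h ω := by
  classical
  have key : flipSign A g (fun x => ω (h⁻¹ • x)) =
      ∏ᶠ x, (if h • x ∈ A then ω x else 1) * (if g • h • x ∈ A then ω x else 1) := by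
    rw [flipSign, ← finprod_comp_equiv (MulAction.toPerm h)]
    simp only [MulAction.toPerm_apply, inv_smul_smul]
  have hfin : (Function.mulSupport fun x =>
      (if h • x ∈ A then ω x else 1) * (if g • h • x ∈ A then ω x else 1)).Finite := by
    refine ((hA (g * h)).union (hA h)).subset fun x hx => ?_
    by_contra hn
    apply hx
    simp only [Set.mem_union, Set.mem_ofPred_eq, not_or, not_not, mul_smul] at hn
    by_cases h₁ : h • x ∈ A
    · simp [h₁, hn.1.2 (hn.2.1 h₁), Int.units_mul_self]
    · have h₂ : g • h • x ∉ A := fun h₃ => h₁ (hn.2.2 (hn.1.1 h₃))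
      simp [h₁, h₂]
  rw [key, mul_comm]
  simp only [flipSign]
  rw [← finprod_mul_distrib ((hA h).subset (mulSupport_flipSign_subset A h ω)) hfin]
  refine finprod_congr fun x => ?_
  rw [mul_smul]
  split_ifs <;> simp [Int.units_mul_self]

theorem measurable_flipSign {A : Set X} {g : G} (hg : {x | ¬(g • x ∈ A ↔ x ∈ A)}.Finite) :
    Measurable (flipSign A g) := by
  have : flipSign A g = fun ω => ∏ x ∈ hg.toFinset, ω x := funext (flipSign_eq_prod hg)
  rw [this]
  exact Finset.measurable_fun_prod _ fun x _ => measurable_pi_apply x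

theorem integral_flipSign {A : Set X} {g : G} (hg : {x | ¬(g • x ∈ A ↔ x ∈ A)}.Finite)
    {r : ℝ} (h₁ : -1 ≤ r) (h₂ : r ≤ 1) :
    ∫ ω, ((flipSign A g ω : ℤ) : ℝ) ∂(Measure.infinitePi fun _ : X => signMeasure r) =
      r ^ {x | ¬(g • x ∈ A ↔ x ∈ A)}.ncard := by
  have := isProbabilityMeasure_signMeasure h₁ h₂
  have hp : ∀ ω : X → ℤˣ, ((flipSign A g ω : ℤ) : ℝ) =
      (fun y : hg.toFinset → ℤˣ => ∏ i, (((y i : ℤˣ) : ℤ) : ℝ)) (hg.toFinset.restrict ω) := by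
    intro ω
    rw [flipSign_eq_prod hg, Units.coe_prod, Int.cast_prod,
      ← Finset.prod_coe_sort hg.toFinset (fun x => ((ω x : ℤ) : ℝ))]
    rfl
  simp_rw [hp]
  rw [integral_restrict_infinitePi (fun _ : X => signMeasure r)
    (f := fun y : hg.toFinset → ℤˣ => ∏ i, (((y i : ℤˣ) : ℤ) : ℝ))
    (Measurable.of_discrete).aestronglyMeasurable,
    integral_fintype_prod_eq_prod (fun _ u => (((u : ℤˣ) : ℤ) : ℝ))]
  simp only [integral_signMeasure h₁ h₂, Finset.prod_const, Finset.card_univ, Fintype.card_coe]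
  rw [Set.ncard_eq_toFinset_card _ hg]

theorem measurePreserving_comp_smul (ρ : Measure ℤˣ) [IsProbabilityMeasure ρ] (g : G) :
    MeasurePreserving (fun (ω : X → ℤˣ) x => ω (g • x))
      (Measure.infinitePi fun _ : X => ρ) (Measure.infinitePi fun _ : X => ρ) := by
  have h := Measure.infinitePi_map_piCongrLeft (fun _ : X => ρ) (MulAction.toPerm g⁻¹ : X ≃ X)
  refine ⟨measurable_pi_lambda _ fun x => measurable_pi_apply _, ?_⟩
  convert h using 2
  ext ω x : 2
  obtain ⟨y, rfl⟩ := (MulAction.toPerm g⁻¹ : X ≃ X).surjective x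
  simp [MeasurableEquiv.coe_piCongrLeft, Equiv.piCongrLeft_apply]


theorem measurePreserving_flipSign_skew {A : Set X}
    (hA : ∀ g : G, {x | ¬(g • x ∈ A ↔ x ∈ A)}.Finite)
    (ρ : Measure ℤˣ) [IsProbabilityMeasure ρ] (g : G) :
    MeasurePreserving
      (fun p : (X → ℤˣ) × ℤˣ => ((fun x => p.1 (g⁻¹ • x)), flipSign A g p.1 * p.2))
      ((Measure.infinitePi fun _ : X => ρ).prod (signMeasure 0))
      ((Measure.infinitePi fun _ : X => ρ).prod (signMeasure 0)) := by
  have := isProbabilityMeasure_signMeasure (r := 0) (by norm_num) (by norm_num)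
  refine (measurePreserving_comp_smul ρ g⁻¹).skew_product (g := fun ω z => flipSign A g ω * z)
    (((measurable_flipSign (hA g)).comp measurable_fst).mul measurable_snd) ?_
  exact Filter.Eventually.of_forall fun ω => map_mul_left_signMeasure_zero _

theorem MeasureTheory.MemLp.norm_toLp_sq {Y : Type*} [MeasurableSpace Y] {μ : Measure Y}
    {f : Y → ℂ} (hf : MemLp f 2 μ) : ‖hf.toLp‖ ^ 2 = ∫ y, ‖f y‖ ^ 2 ∂μ := by
  have h := hf.eLpNorm_eq_integral_rpow_norm (by norm_num) (by norm_num)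
  have h0 : 0 ≤ ∫ y, ‖f y‖ ^ 2 ∂μ := integral_nonneg fun _ => by positivity
  rw [Lp.norm_toLp, h, ENNReal.toReal_ofReal (by positivity)]
  simp only [ENNReal.toReal_ofNat, Real.rpow_ofNat]
  rw [← Real.rpow_natCast, ← Real.rpow_mul h0]
  norm_num

/-- For an action commensurating `A`, the kernel `r ^ #(A ∆ g • A)` is a matrix coefficient of a
unitary representation. -/
theorem exists_rep_norm_sub_sq {A : Set X}
    (hA : ∀ g : G, {x | ¬(g • x ∈ A ↔ x ∈ A)}.Finite) {r : ℝ} (h₁ : -1 ≤ r) (h₂ : r ≤ 1) :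
    ∃ (E : Type) (_ : NormedAddCommGroup E) (_ : InnerProductSpace ℂ E)
      (_ : CompleteSpace E) (π : G →* (E ≃ₗᵢ[ℂ] E)) (ξ : E),
      ∀ g, ‖π g ξ - ξ‖ ^ 2 = 2 - 2 * r ^ {x | ¬(g⁻¹ • x ∈ A ↔ x ∈ A)}.ncard := by
  have := isProbabilityMeasure_signMeasure h₁ h₂
  have := isProbabilityMeasure_signMeasure (r := 0) (by norm_num) (by norm_num)
  set ν := Measure.infinitePi fun _ : X => signMeasure r
  obtain ⟨π, hπ⟩ := exists_koopman_rep (G := G) (ν.prod (signMeasure 0))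
    (fun g p => ((fun x => p.1 (g⁻¹ • x)), flipSign A g p.1 * p.2))
    (fun p => by simp [flipSign_one])
    (fun g h p => by simp only [flipSign_mul hA, mul_inv_rev, mul_smul, mul_assoc])
    (measurePreserving_flipSign_skew hA _)
  have hf : MemLp (fun p : (X → ℤˣ) × ℤˣ => (((p.2 : ℤˣ) : ℤ) : ℂ)) 2
      (ν.prod (signMeasure 0)) := by
    refine MemLp.of_bound (C := 1) ?_ (Filter.Eventually.of_forall fun p => ?_)
    · exact ((Measurable.of_discrete (f := fun u : ℤˣ => ((u : ℤ) : ℂ))).comp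
        measurable_snd).aestronglyMeasurable
    · rcases Int.units_eq_one_or p.2 with h | h <;> simp [h]
  refine ⟨_, _, _, inferInstance, π, hf.toLp, fun g => ?_⟩
  rw [hπ, ← MemLp.toLp_sub, MemLp.norm_toLp_sq]
  have hpt : ∀ p : (X → ℤˣ) × ℤˣ,
      ‖(((flipSign A g⁻¹ p.1 * p.2 : ℤˣ) : ℤ) : ℂ) - ((p.2 : ℤ) : ℂ)‖ ^ 2 =
        2 - 2 * ((flipSign A g⁻¹ p.1 : ℤ) : ℝ) := by
    intro p
    rcases Int.units_eq_one_or p.2 with h | h <;>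
    rcases Int.units_eq_one_or (flipSign A g⁻¹ p.1) with h' | h' <;>
    simp only [h, h'] <;> norm_num
  have hint : Integrable (fun ω => ((flipSign A g⁻¹ ω : ℤ) : ℝ)) ν := by
    refine Integrable.of_bound (C := 1) ?_ (Filter.Eventually.of_forall fun ω => ?_)
    · exact ((Measurable.of_discrete (f := fun u : ℤˣ => ((u : ℤ) : ℝ))).comp
        (measurable_flipSign (hA g⁻¹))).aestronglyMeasurable
    · rcases Int.units_eq_one_or (flipSign A g⁻¹ ω) with h | h <;> simp [h]
  calc _ = ∫ p, (2 - 2 * ((flipSign A g⁻¹ p.1 : ℤ) : ℝ)) ∂(ν.prod (signMeasure 0)) :=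
        integral_congr_ae (Filter.Eventually.of_forall hpt)
    _ = ∫ ω, (2 - 2 * ((flipSign A g⁻¹ ω : ℤ) : ℝ)) ∂ν := by
        rw [integral_fun_fst (fun ω => 2 - 2 * ((flipSign A g⁻¹ ω : ℤ) : ℝ))]
        simp
    _ = _ := by
        rw [integral_sub (integrable_const _) (hint.const_mul _), integral_const_mul,
          integral_flipSign (hA g⁻¹) h₁ h₂]
        simp

end FlipSign

/-- A group acting on a set `X` such that some `A ⊆ X` is commensurated, with `#(A ∆ g • A)`
unbounded, does not have property (T). -/
theorem not_kazhdan_of_commensurated {G X : Type} [Group G] [MulAction G X] {A : Set X}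
    (hA : ∀ g : G, {x | ¬(g • x ∈ A ↔ x ∈ A)}.Finite)
    (hunb : ∀ n : ℕ, ∃ g : G, n ≤ {x | ¬(g • x ∈ A ↔ x ∈ A)}.ncard)
    (S : Finset G) {ε : ℝ} (hε : 0 < ε) :
    ∃ (E : Type) (_ : NormedAddCommGroup E) (_ : InnerProductSpace ℂ E)
      (_ : CompleteSpace E) (π : G →* (E ≃ₗᵢ[ℂ] E)) (ξ : E),
      ‖ξ‖ = 1 ∧ (∀ s ∈ S, ‖π s ξ - ξ‖ < ε) ∧
      ∀ v : E, (∀ g : G, π g v = v) → v = 0 := by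
  let ψ : G → ℕ := fun g => {x | ¬(g⁻¹ • x ∈ A ↔ x ∈ A)}.ncard
  have hr : ∃ r : ℝ, (∀ s ∈ S, 2 - 2 * r ^ ψ s < (ε / 2) ^ 2) ∧ 0 < r ∧ r < 1 := by
    have hS : ∀ᶠ r in nhdsWithin (1 : ℝ) (Set.Iio 1),
        ∀ s ∈ S, 2 - 2 * r ^ ψ s < (ε / 2) ^ 2 := by
      rw [Filter.eventually_all_finset]
      intro s _
      have hc : Filter.Tendsto (fun r : ℝ => 2 - 2 * r ^ ψ s)
          (nhdsWithin (1 : ℝ) (Set.Iio 1)) (nhds (2 - 2 * 1 ^ ψ s)) :=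
        (Continuous.tendsto (by fun_prop) 1).mono_left nhdsWithin_le_nhds
      refine hc.eventually_lt_const ?_
      rw [one_pow]
      norm_num
      positivity
    have h01 : ∀ᶠ r in nhdsWithin (1 : ℝ) (Set.Iio 1), 0 < r ∧ r < 1 :=
      Ioo_mem_nhdsLT one_pos
    exact (hS.and h01).exists
  obtain ⟨r, hrS, hr0, hr1⟩ := hr
  obtain ⟨E, i₁, i₂, i₃, π, ξ, hξ⟩ := exists_rep_norm_sub_sq hA (r := r) (by linarith) hr1.le
  refine exists_rep_without_fixed_vectors π ξ S ε (fun s hs => ?_) ?_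
  · refine lt_of_pow_lt_pow_left₀ 2 (by positivity) ?_
    rw [hξ]
    exact hrS s hs
  · obtain ⟨n, hn⟩ := exists_pow_lt_of_lt_one (show (0 : ℝ) < 1 / 2 by norm_num) hr1
    obtain ⟨g, hg⟩ := hunb n
    refine ⟨g⁻¹, le_of_sq_le_sq ?_ (norm_nonneg _)⟩
    rw [hξ, inv_inv]
    have := pow_le_pow_of_le_one hr0.le hr1.le hg
    linarith

theorem IsDyadic.exists_eq_div_of_le {x : ℝ} (hx : IsDyadic x) :
    ∃ b : ℕ, ∀ n, b ≤ n → ∃ a : ℤ, x = a / 2 ^ n := by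
  obtain ⟨a, b, rfl⟩ := hx
  refine ⟨b, fun n hn => ⟨a * 2 ^ (n - b), ?_⟩⟩
  obtain ⟨m, rfl⟩ := Nat.exists_eq_add_of_le hn
  rw [Nat.add_sub_cancel_left, pow_add]
  push_cast
  field_simp

theorem IsDyadic.sub {x y : ℝ} (hx : IsDyadic x) (hy : IsDyadic y) : IsDyadic (x - y) := by
  obtain ⟨b, hb⟩ := hx.exists_eq_div_of_le
  obtain ⟨c, hc⟩ := hy.exists_eq_div_of_le
  obtain ⟨p, rfl⟩ := hb (max b c) (le_max_left _ _)
  obtain ⟨q, rfl⟩ := hc (max b c) (le_max_right _ _)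
  exact ⟨p - q, max b c, by push_cast; ring⟩

theorem IsDyadic.zpow_mul {x : ℝ} (hx : IsDyadic x) (k : ℤ) : IsDyadic ((2 : ℝ) ^ k * x) := by
  obtain ⟨a, b, rfl⟩ := hx
  obtain ⟨n, rfl | rfl⟩ := k.eq_nat_or_neg
  · exact ⟨2 ^ n * a, b, by push_cast; rw [zpow_natCast]; ring⟩
  · refine ⟨a, b + n, ?_⟩
    rw [zpow_neg, zpow_natCast, pow_add]
    field_simp

/-- The canonical affine parametrization of the standard dyadic arc `[k / 2 ^ n, (k + 1) / 2 ^ n]`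
of the circle. -/
noncomputable def dyadicArc (n : ℕ) (k : ℤ) (t : Set.Icc (0 : ℝ) 1) : AddCircle (1 : ℝ) :=
  (((k + t) / 2 ^ n : ℝ) : AddCircle (1 : ℝ))

theorem AddCircle.coe_eq_coe_iff_exists_int {x y : ℝ} :
    (x : AddCircle (1 : ℝ)) = y ↔ ∃ j : ℤ, x = y + j := by
  rw [← sub_eq_zero, ← AddCircle.coe_sub, AddCircle.coe_eq_zero_iff]
  refine exists_congr fun j => ?_
  rw [zsmul_one, eq_comm, sub_eq_iff_eq_add']

theorem dyadicArc_emod (n : ℕ) (k : ℤ) : dyadicArc n (k % 2 ^ n) = dyadicArc n k := by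
  ext t
  refine AddCircle.coe_eq_coe_iff_exists_int.2 ⟨-(k / 2 ^ n), ?_⟩
  have h : ((k % 2 ^ n : ℤ) : ℝ) + 2 ^ n * ((k / 2 ^ n : ℤ) : ℝ) = k := by
    exact_mod_cast Int.emod_add_mul_ediv k (2 ^ n)
  rw [← h]
  push_cast
  field_simp
  ring

/-- If `dyadicArc m k` and `dyadicArc m' k'` differ by a rotation then `m = m'`. -/
theorem eq_of_dyadicArc_add_eq {m m' : ℕ} {k k' : ℤ} {c : ℝ}
    (h : ∀ t, dyadicArc m k t + (c : AddCircle (1 : ℝ)) = dyadicArc m' k' t) : m = m' := by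
  have h₀ := h ⟨0, by norm_num⟩
  have h₁ := h ⟨1, by norm_num⟩
  rw [dyadicArc, dyadicArc, ← AddCircle.coe_add, AddCircle.coe_eq_coe_iff_exists_int] at h₀ h₁
  simp only [add_zero] at h₀ h₁
  obtain ⟨i, hi⟩ := h₀
  obtain ⟨j, hj⟩ := h₁
  have hji : (1 / 2 ^ m - 1 / 2 ^ m' : ℝ) = ((j - i : ℤ) : ℝ) := by
    push_cast
    rw [add_div, add_div] at hj
    linarith
  have hb : ∀ n : ℕ, (0 : ℝ) < 1 / 2 ^ n ∧ (1 : ℝ) / 2 ^ n ≤ 1 := fun n =>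
    ⟨by positivity, by rw [div_le_one (by positivity)]; exact one_le_pow₀ one_le_two⟩
  have hlt : ((j - i : ℤ) : ℝ) < (1 : ℤ) := by
    rw [← hji]; push_cast; linarith [(hb m).2, (hb m').1]
  have hgt : ((-1 : ℤ) : ℝ) < ((j - i : ℤ) : ℝ) := by
    rw [← hji]; push_cast; linarith [(hb m').2, (hb m).1]
  rw [Int.cast_lt] at hlt hgt
  have hz : j - i = 0 := by omega
  rw [hz, Int.cast_zero, sub_eq_zero, one_div, one_div, inv_inj] at hji
  exact Nat.pow_right_injective le_rfl (by exact_mod_cast hji : 2 ^ m = 2 ^ m')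

/-- An affine map with slope a power of `2` and dyadic constant term maps standard dyadic intervals
of high level affinely to standard dyadic intervals. -/
theorem exists_level_of_affineOn {G : ℝ → ℝ} {a b c : ℝ} {κ : ℤ} (hb : IsDyadic b)
    (hc : IsDyadic c) (hG : ∀ t ∈ Set.Icc a b, G t = (2 : ℝ) ^ κ * t + c) :
    ∃ N : ℕ, ∀ n, N ≤ n → ∀ k : ℤ, a ≤ k / 2 ^ n → (k : ℝ) / 2 ^ n < b →
      ∃ (m : ℕ) (l : ℤ), ∀ t ∈ Set.Icc (0 : ℝ) 1, G ((k + t) / 2 ^ n) = (l + t) / 2 ^ m := by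
  obtain ⟨p, hp⟩ := hb.exists_eq_div_of_le
  obtain ⟨q, hq⟩ := hc.exists_eq_div_of_le
  refine ⟨p + q + κ.natAbs, fun n hn k ha hkb => ?_⟩
  obtain ⟨m, hm⟩ := Int.eq_ofNat_of_zero_le (show 0 ≤ (n : ℤ) - κ by omega)
  obtain ⟨b', rfl⟩ := hp n (by omega)
  obtain ⟨c', rfl⟩ := hq m (by omega)
  have h2n : (0 : ℝ) < 2 ^ n := by positivity
  rw [div_lt_div_iff_of_pos_right h2n, Int.cast_lt] at hkb
  have hkb' : (k : ℝ) + 1 ≤ b' := by exact_mod_cast hkb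
  have hκ : (2 : ℝ) ^ κ = 2 ^ n / 2 ^ m := by
    rw [show κ = (n : ℤ) - m by omega, zpow_sub₀ two_ne_zero, zpow_natCast, zpow_natCast]
  refine ⟨m, k + c', fun t ht => ?_⟩
  rw [hG, hκ]
  · push_cast
    field_simp
    ring
  · refine ⟨ha.trans ?_, ?_⟩
    · gcongr
      linarith [ht.1]
    · gcongr
      linarith [ht.2]

theorem exists_castSucc_le_lt_succ {n : ℕ} {x : Fin (n + 1) → ℝ} {t : ℝ} (h₀ : x 0 ≤ t)
    (h₁ : t < x (Fin.last n)) : ∃ i : Fin n, x i.castSucc ≤ t ∧ t < x i.succ := by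
  by_contra! h
  have hle : ∀ i, x i ≤ t := fun i => by
    induction i using Fin.induction with
    | zero => exact h₀
    | succ i ih => exact h i ih
  exact absurd (hle (Fin.last n)) (not_le.2 h₁)

/-- The set of all standard dyadic arcs. -/
def dyadicArcs : Set (Set.Icc (0 : ℝ) 1 → AddCircle (1 : ℝ)) :=
  {f | ∃ n k, f = dyadicArc n k}

theorem IsThompsonT.finite_comp_notMem_dyadicArcs
    {g : AddCircle (1 : ℝ) ≃ₜ AddCircle (1 : ℝ)} (hg : IsThompsonT g) :
    {f | f ∈ dyadicArcs ∧ (fun t => g (f t)) ∉ dyadicArcs}.Finite := by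
  obtain ⟨G, ⟨-, -, -, hdy, r, x, hx₀, hx₁, hmono, hx, haff⟩, hgG⟩ := hg
  have hlevel : ∀ i : Fin r, ∃ N : ℕ, ∀ n, N ≤ n → ∀ k : ℤ, x i.castSucc ≤ k / 2 ^ n →
      (k : ℝ) / 2 ^ n < x i.succ →
      ∃ (m : ℕ) (l : ℤ), ∀ t ∈ Set.Icc (0 : ℝ) 1, G ((k + t) / 2 ^ n) = (l + t) / 2 ^ m := by
    intro i
    obtain ⟨κ, c, hc⟩ := haff i
    have hc' : c = G (x i.castSucc) - (2 : ℝ) ^ κ * x i.castSucc := by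
      rw [hc _ (Set.left_mem_Icc.2 (hmono i.castSucc_lt_succ).le)]
      ring
    exact exists_level_of_affineOn (hx _) (hc' ▸ (hdy _ (hx _)).sub ((hx _).zpow_mul κ)) hc
  choose N hN using hlevel
  refine ((Finset.range (Finset.univ.sup N)).finite_toSet.biUnion fun n _ =>
    (Set.finite_Ico (0 : ℤ) (2 ^ n)).image (dyadicArc n)).subset ?_
  rintro _ ⟨⟨n, k, rfl⟩, hk⟩
  have hpos : (0 : ℤ) < 2 ^ n := by positivity
  rw [← dyadicArc_emod] at hk ⊢
  have hk₀ : 0 ≤ k % 2 ^ n := Int.emod_nonneg _ hpos.ne'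
  have hk₁ : k % 2 ^ n < 2 ^ n := Int.emod_lt_of_pos _ hpos
  generalize k % 2 ^ n = k at hk hk₀ hk₁ ⊢
  simp only [Set.mem_iUnion]
  refine ⟨n, ?_, k, ⟨hk₀, hk₁⟩, rfl⟩
  rw [Finset.mem_coe, Finset.mem_range]
  by_contra! hn
  obtain ⟨i, hi₀, hi₁⟩ := exists_castSucc_le_lt_succ (x := x) (t := (k : ℝ) / 2 ^ n)
    (by rw [hx₀]; have : (0 : ℝ) ≤ k := by exact_mod_cast hk₀
        positivity)
    (by rw [hx₁, div_lt_one (by positivity)]; exact_mod_cast hk₁)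
  obtain ⟨m, l, hml⟩ := hN i n ((Finset.le_sup (Finset.mem_univ i)).trans hn) k hi₀ hi₁
  refine hk ⟨m, l, funext fun t => ?_⟩
  rw [dyadicArc, dyadicArc, hgG, hml t t.2]

theorem isThompsonT_addRight (n : ℕ) :
    IsThompsonT (Homeomorph.addRight ((1 / 2 ^ n : ℝ) : AddCircle (1 : ℝ))) := by
  have hd : IsDyadic (1 / 2 ^ n) := ⟨1, n, by simp⟩
  refine ⟨fun x => x + 1 / 2 ^ n, ⟨by fun_prop, fun _ _ h => by simpa using h, fun x => by ring,
    fun q hq => ?_, 1, ![0, 1], rfl, rfl, ?_, ?_, fun i => ⟨0, 1 / 2 ^ n, fun t _ => by simp⟩⟩,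
    fun x => ?_⟩
  · have h0 : IsDyadic (0 - 1 / 2 ^ n) := IsDyadic.sub ⟨0, 0, by simp⟩ hd
    simpa using hq.sub h0
  · intro i j hij
    fin_cases i <;> fin_cases j <;> simp_all
  · intro i
    fin_cases i
    · exact ⟨0, 0, by simp⟩
    · exact ⟨1, 0, by simp⟩
  · rw [Homeomorph.coe_addRight, AddCircle.coe_add]

theorem dyadicArc_add_notMem_dyadicArcs {m n : ℕ} (hmn : m < n) :
    (fun t => dyadicArc m 0 t + ((1 / 2 ^ n : ℝ) : AddCircle (1 : ℝ))) ∉ dyadicArcs := by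
  rintro ⟨m', l, h⟩
  obtain rfl := eq_of_dyadicArc_add_eq (congrFun h)
  have h₀ := congrFun h ⟨0, by norm_num⟩
  simp only [dyadicArc] at h₀
  rw [← AddCircle.coe_add, AddCircle.coe_eq_coe_iff_exists_int] at h₀
  obtain ⟨j, hj⟩ := h₀
  obtain ⟨d, rfl⟩ := Nat.exists_eq_add_of_lt hmn
  have hj' : (1 : ℝ) = 2 * (2 ^ d * (l + j * 2 ^ m)) := by
    rw [pow_succ, pow_add] at hj
    field_simp at hj
    simp at hj
    linarith
  have : (1 : ℤ) = 2 * (2 ^ d * (l + j * 2 ^ m)) := by exact_mod_cast hj'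
  omega

/-- Thompson's group `T` (realized as the subgroup `H` of the group of homeomorphisms of
the circle `ℝ/ℤ`) does not have Kazhdan's property (T): for every finite `S ⊆ T` and
`ε > 0` there are a complex Hilbert space, a unitary representation `π` of `T` on it and
a unit vector `ξ` with `‖π(s)ξ − ξ‖ < ε` for all `s ∈ S`, while the only `π(T)`-fixed
vector is `0`. -/
theorem thompsonT_not_kazhdan
    (H : Subgroup (AddCircle (1:ℝ) ≃ₜ AddCircle (1:ℝ)))
    (hH : ∀ g, g ∈ H ↔ IsThompsonT g) :
    ∀ (S : Finset H) (ε : ℝ), 0 < ε →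
      ∃ (E : Type) (_ : NormedAddCommGroup E) (_ : InnerProductSpace ℂ E)
        (_ : CompleteSpace E) (π : H →* (E ≃ₗᵢ[ℂ] E)) (ξ : E),
        ‖ξ‖ = 1 ∧ (∀ s ∈ S, ‖π s ξ - ξ‖ < ε) ∧
        ∀ v : E, (∀ g : H, π g v = v) → v = 0 := by
  intro S ε hε
  let _ : MulAction H (Set.Icc (0 : ℝ) 1 → AddCircle (1 : ℝ)) :=
    { smul := fun g f t => g.1 (f t)
      one_smul := fun _ => rfl
      mul_smul := fun _ _ _ => rfl }
  have hfin : ∀ g : H, {f | f ∈ dyadicArcs ∧ g • f ∉ dyadicArcs}.Finite := fun g =>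
    ((hH g).1 g.2).finite_comp_notMem_dyadicArcs
  have hfin' : ∀ g : H, {f | ¬(g • f ∈ dyadicArcs ↔ f ∈ dyadicArcs)}.Finite := by
    intro g
    refine ((hfin g).union ((hfin g⁻¹).image (g⁻¹ • ·))).subset fun f hf => ?_
    by_cases h : f ∈ dyadicArcs
    · exact Or.inl ⟨h, fun h' => hf (iff_of_true h' h)⟩
    · have h' : g • f ∈ dyadicArcs := by
        by_contra h'
        exact hf (iff_of_false h' h)
      exact Or.inr ⟨g • f, ⟨h', by rwa [inv_smul_smul]⟩, inv_smul_smul g f⟩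
  refine not_kazhdan_of_commensurated hfin' (fun n => ?_) S hε
  let g : H := ⟨_, (hH _).2 (isThompsonT_addRight n)⟩
  have hinj : Function.Injective fun m : ℕ => dyadicArc m 0 := fun m m' h =>
    eq_of_dyadicArc_add_eq (k := 0) (k' := 0) (c := 0) fun t => by
      rw [AddCircle.coe_zero, add_zero]
      exact congrFun h t
  refine ⟨g, ?_⟩
  calc n = ((fun m : ℕ => dyadicArc m 0) '' (Finset.range n : Set ℕ)).ncard := by
        rw [Set.ncard_image_of_injective _ hinj, Set.ncard_coe_finset, Finset.card_range]
    _ ≤ _ := by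
        refine Set.ncard_le_ncard ?_ (hfin' g)
        rintro _ ⟨m, hm, rfl⟩ h
        exact dyadicArc_add_notMem_dyadicArcs (Finset.mem_range.1 hm) (h.2 ⟨m, 0, rfl⟩)
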